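/- For every δ > 0 and every a ∈ ℝ, the two absolutely convergent series satisfy (δ/√(2π)) Σ_{j∈ℤ} (jδ) e^{−(jδ)²/2} e^{−i a j δ} = −i Σ_{k∈ℤ} (a + 2πk/δ) e^{−(a + 2πk/δ)²/2}. -/

import Mathlib

open scoped Real

/-- The summand of the Gaussian-weighted lattice sum is a multiple of the summand of
`jacobiTheta₂'`. -/
lemma lattice_mul_exp_eq_jacobiTheta₂'_term (δ a : ℝ) (j : ℤ) :
    (((j : ℝ) * δ : ℝ) : ℂ) * Complex.exp (-((j : ℝ) * δ) ^ 2 / 2) *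
        Complex.exp (-Complex.I * a * (j : ℝ) * δ) =
      δ / (2 * π * Complex.I) *
        jacobiTheta₂'_term j (-(a * δ / (2 * π))) (Complex.I * δ ^ 2 / (2 * π)) := by
  have hπ : (π : ℂ) ≠ 0 := Complex.ofReal_ne_zero.mpr Real.pi_ne_zero
  rw [jacobiTheta₂'_term, jacobiTheta₂_term, mul_assoc, ← Complex.exp_add,
    show 2 * π * Complex.I * j * (-(a * δ / (2 * π))) +
        π * Complex.I * j ^ 2 * (Complex.I * δ ^ 2 / (2 * π)) =
      -((j : ℝ) * δ) ^ 2 / 2 + -Complex.I * a * (j : ℝ) * δ by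
        push_cast
        field_simp
        linear_combination (δ ^ 2 * (j : ℂ) ^ 2) * Complex.I_sq]
  push_cast
  field_simp [Complex.I_ne_zero]

/-- The summand of the shifted dual lattice sum as a combination of the summands of
`jacobiTheta₂'` and `jacobiTheta₂`. -/
lemma ofReal_shifted_mul_exp_eq_jacobiTheta₂_terms {δ : ℝ} (hδ : δ ≠ 0) (a : ℝ) (k : ℤ) :
    (((a + 2 * π * (k : ℝ) / δ) * Real.exp (-(a + 2 * π * (k : ℝ) / δ) ^ 2 / 2) : ℝ) : ℂ) =
      Complex.exp (-a ^ 2 / 2) / (Complex.I * δ) *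
        (jacobiTheta₂'_term k (Complex.I * a / δ) (2 * π * Complex.I / δ ^ 2) -
          2 * π * Complex.I * (-(a * δ / (2 * π))) *
            jacobiTheta₂_term k (Complex.I * a / δ) (2 * π * Complex.I / δ ^ 2)) := by
  have hπ : (π : ℂ) ≠ 0 := Complex.ofReal_ne_zero.mpr Real.pi_ne_zero
  have hδ' : (δ : ℂ) ≠ 0 := Complex.ofReal_ne_zero.mpr hδ
  have hexp : Complex.exp (-(a + 2 * π * k / δ) ^ 2 / 2) =
      Complex.exp (-a ^ 2 / 2) *
        jacobiTheta₂_term k (Complex.I * a / δ) (2 * π * Complex.I / δ ^ 2) := by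
    rw [jacobiTheta₂_term, ← Complex.exp_add]
    congr 1
    field_simp
    linear_combination (-(4 * π * k * a * δ + 4 * π ^ 2 * k ^ 2) : ℂ) * Complex.I_sq
  push_cast
  rw [hexp, jacobiTheta₂'_term]
  field_simp [Complex.I_ne_zero]
  ring

/-- **Poisson summation for `ω ↦ ω e^{−ω²/2} e^{−iaω}`.** For every `δ > 0` and
`a ∈ ℝ`, `(δ/√(2π)) Σ_{j∈ℤ} (jδ) e^{−(jδ)²/2} e^{−i a j δ}
= −i Σ_{k∈ℤ} (a + 2πk/δ) e^{−(a + 2πk/δ)²/2}`, both series being absolutely convergent. -/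
theorem poisson_summation_gaussian_deriv (δ a : ℝ) (hδ : 0 < δ) :
    Summable (fun j : ℤ =>
      (((j : ℝ) * δ : ℝ) : ℂ) * Complex.exp (-((j : ℝ) * δ) ^ 2 / 2) *
        Complex.exp (-Complex.I * a * (j : ℝ) * δ)) ∧
    Summable (fun k : ℤ =>
      (a + 2 * π * (k : ℝ) / δ) * Real.exp (-(a + 2 * π * (k : ℝ) / δ) ^ 2 / 2)) ∧
    ((δ / Real.sqrt (2 * π) : ℝ) : ℂ) *
        ∑' j : ℤ,
          (((j : ℝ) * δ : ℝ) : ℂ) * Complex.exp (-((j : ℝ) * δ) ^ 2 / 2) *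
            Complex.exp (-Complex.I * a * (j : ℝ) * δ) =
      -Complex.I *
        ((∑' k : ℤ,
          (a + 2 * π * (k : ℝ) / δ) * Real.exp (-(a + 2 * π * (k : ℝ) / δ) ^ 2 / 2) : ℝ) : ℂ) := by
  have hπ : (π : ℂ) ≠ 0 := Complex.ofReal_ne_zero.mpr Real.pi_ne_zero
  have hδ' : (δ : ℂ) ≠ 0 := Complex.ofReal_ne_zero.mpr hδ.ne'
  have hτ : 0 < (Complex.I * δ ^ 2 / (2 * π)).im := by
    rw [show Complex.I * δ ^ 2 / (2 * π) = ((δ ^ 2 / (2 * π) : ℝ) : ℂ) * Complex.I by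
      push_cast; ring, Complex.im_ofReal_mul, Complex.I_im]
    positivity
  have hτ' : 0 < (2 * π * Complex.I / δ ^ 2).im := by
    rw [show 2 * π * Complex.I / δ ^ 2 = ((2 * π / δ ^ 2 : ℝ) : ℂ) * Complex.I by
      push_cast; ring, Complex.im_ofReal_mul, Complex.I_im]
    positivity
  have hL := (hasSum_jacobiTheta₂'_term (-(a * δ / (2 * π))) hτ).mul_left
    (δ / (2 * π * Complex.I) : ℂ)
  have hR := ((hasSum_jacobiTheta₂'_term (Complex.I * a / δ) hτ').sub
    ((hasSum_jacobiTheta₂_term (Complex.I * a / δ) hτ').mul_left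
      (2 * π * Complex.I * (-(a * δ / (2 * π)))))).mul_left
    (Complex.exp (-a ^ 2 / 2) / (Complex.I * δ))
  simp_rw [← lattice_mul_exp_eq_jacobiTheta₂'_term] at hL
  simp_rw [← ofReal_shifted_mul_exp_eq_jacobiTheta₂_terms hδ.ne'] at hR
  refine ⟨hL.summable, Complex.summable_ofReal.mp hR.summable, ?_⟩
  have hroot : (-Complex.I * (Complex.I * δ ^ 2 / (2 * π))) ^ (1 / 2 : ℂ) =
      ((δ / Real.sqrt (2 * π) : ℝ) : ℂ) := by
    rw [show -Complex.I * (Complex.I * δ ^ 2 / (2 * π)) = ((δ ^ 2 / (2 * π) : ℝ) : ℂ) by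
        push_cast; linear_combination (-(δ ^ 2 / (2 * π)) : ℂ) * Complex.I_sq,
      show (1 / 2 : ℂ) = ((1 / 2 : ℝ) : ℂ) by push_cast; rfl,
      ← Complex.ofReal_cpow (by positivity), ← Real.sqrt_eq_rpow,
      Real.sqrt_div (sq_nonneg δ), Real.sqrt_sq hδ.le]
  have hprefactor : ((δ / Real.sqrt (2 * π) : ℝ) : ℂ) ≠ 0 :=
    Complex.ofReal_ne_zero.mpr (by positivity)
  rw [Complex.ofReal_tsum, hL.tsum_eq, hR.tsum_eq, jacobiTheta₂'_functional_equation, hroot,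
    show -(a * δ / (2 * π)) / (Complex.I * δ ^ 2 / (2 * π)) = Complex.I * a / δ by
      field_simp [Complex.I_ne_zero]
      linear_combination (-a : ℂ) * Complex.I_sq,
    show -1 / (Complex.I * δ ^ 2 / (2 * π)) = 2 * π * Complex.I / δ ^ 2 by
      field_simp [Complex.I_ne_zero]
      linear_combination -Complex.I_sq,
    show -π * Complex.I * (-(a * δ / (2 * π))) ^ 2 / (Complex.I * δ ^ 2 / (2 * π)) =
        (-a ^ 2 / 2 : ℂ) by
      field_simp [Complex.I_ne_zero]]
  generalize ((δ / Real.sqrt (2 * π) : ℝ) : ℂ) = c at hprefactor ⊢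
  generalize jacobiTheta₂' _ _ = A
  generalize jacobiTheta₂ _ _ = B
  generalize Complex.exp _ = E
  field_simp [Complex.I_ne_zero]
  simp only [Complex.I_sq]
  ring
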